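/- Let (Ω, ℱ, P) be a probability space, let (E, ℰ) and (F, ℱ') be measurable spaces, let K be a Markov kernel from E to F, and let ω ↦ μ_ω and ω ↦ ν_ω be families of probability measures on E such that for every measurable f with sup|f| ≤ 1 the maps ω ↦ ∫ f dμ_ω and ω ↦ ∫ f dν_ω are measurable and square-integrable. With d(μ, ν) := sup over measurable f with sup|f| ≤ 1 of ( E_ω[ |∫ f dμ_ω − ∫ f dν_ω|² ] )^{1/2}, one has d( ω ↦ μ_ω ∘ K, ω ↦ ν_ω ∘ K ) ≤ d(μ, ν), where μ_ω ∘ K denotes the pushforward (bind) of μ_ω through the kernel K. -/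

import Mathlib

open MeasureTheory ProbabilityTheory

/-- The distance between random measures used in the particle filter analysis:
`d(μ, ν) = sup { √(E_ω[ |∫ f dμ_ω − ∫ f dν_ω|² ]) : f measurable, sup |f| ≤ 1 }`. -/
noncomputable def randMeasDist {Ω E : Type*} [MeasurableSpace Ω] [MeasurableSpace E]
    (P : Measure Ω) (μ ν : Ω → Measure E) : ℝ :=
  sSup {r : ℝ | ∃ f : E → ℝ, Measurable f ∧ (∀ x, |f x| ≤ 1) ∧
    r = Real.sqrt (∫ ω, (∫ x, f x ∂(μ ω) - ∫ x, f x ∂(ν ω)) ^ 2 ∂P)}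

/-- An integral of a function bounded by `1` against a probability measure is bounded by `1`. -/
theorem abs_integral_le_one_of_abs_le_one {E : Type*} [MeasurableSpace E] (μ : Measure E)
    [IsProbabilityMeasure μ] {f : E → ℝ} (hf : ∀ x, |f x| ≤ 1) : |∫ x, f x ∂μ| ≤ 1 := by
  simpa using norm_integral_le_of_norm_le_const (μ := μ) (f := f) (C := 1) (.of_forall hf)

/-- The set whose supremum defines `randMeasDist` is bounded above for families of probability
measures. -/
theorem bddAbove_randMeasDist_set {Ω E : Type*} [MeasurableSpace Ω] [MeasurableSpace E]
    (P : Measure Ω) [IsProbabilityMeasure P] (μ ν : Ω → Measure E)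
    (hμ : ∀ ω, IsProbabilityMeasure (μ ω)) (hν : ∀ ω, IsProbabilityMeasure (ν ω)) :
    BddAbove {r : ℝ | ∃ f : E → ℝ, Measurable f ∧ (∀ x, |f x| ≤ 1) ∧
      r = Real.sqrt (∫ ω, (∫ x, f x ∂(μ ω) - ∫ x, f x ∂(ν ω)) ^ 2 ∂P)} := by
  refine ⟨2, ?_⟩
  rintro r ⟨f, -, hf, rfl⟩
  refine Real.sqrt_le_iff.2 ⟨by norm_num, ?_⟩
  have hbound : ∀ ω, ‖(∫ x, f x ∂(μ ω) - ∫ x, f x ∂(ν ω)) ^ 2‖ ≤ 2 ^ 2 := fun ω ↦ by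
    have h₁ := abs_le.1 (abs_integral_le_one_of_abs_le_one (μ ω) hf)
    have h₂ := abs_le.1 (abs_integral_le_one_of_abs_le_one (ν ω) hf)
    rw [norm_pow]
    gcongr
    exact abs_le.2 ⟨by linarith, by linarith⟩
  simpa using (le_abs_self _).trans
    (norm_integral_le_of_norm_le_const (μ := P) (.of_forall hbound))

/-- The integral of a bounded measurable function against `μ.bind K` is an iterated integral. -/
theorem integral_bind_kernel_of_abs_le_one {E F : Type*} [MeasurableSpace E] [MeasurableSpace F]
    (μ : Measure E) [IsProbabilityMeasure μ] (K : Kernel E F) [IsMarkovKernel K]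
    {f : F → ℝ} (hfm : Measurable f) (hf : ∀ y, |f y| ≤ 1) :
    ∫ y, f y ∂(μ.bind K) = ∫ x, ∫ y, f y ∂(K x) ∂μ := by
  have hint : Integrable f ((K ∘ₖ Kernel.const Unit μ) ()) :=
    .of_bound hfm.aestronglyMeasurable 1 (.of_forall hf)
  simpa [Kernel.comp_apply] using Kernel.integral_comp hint

/-- Contraction of the random-measure distance under a Markov kernel (the prediction operator
of the particle filter applied pointwise in `ω`): `d(μ ∘ K, ν ∘ K) ≤ d(μ, ν)`. -/
theorem randMeasDist_kernel_contraction
    {Ω E F : Type*} [MeasurableSpace Ω] [MeasurableSpace E] [MeasurableSpace F]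
    (P : Measure Ω) [IsProbabilityMeasure P]
    (K : Kernel E F) [IsMarkovKernel K]
    (μ ν : Ω → Measure E)
    (hμprob : ∀ ω, IsProbabilityMeasure (μ ω))
    (hνprob : ∀ ω, IsProbabilityMeasure (ν ω))
    (hμ : ∀ f : E → ℝ, Measurable f → (∀ x, |f x| ≤ 1) →
      Measurable (fun ω => ∫ x, f x ∂(μ ω)) ∧
        Integrable (fun ω => (∫ x, f x ∂(μ ω)) ^ 2) P)
    (hν : ∀ f : E → ℝ, Measurable f → (∀ x, |f x| ≤ 1) →
      Measurable (fun ω => ∫ x, f x ∂(ν ω)) ∧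
        Integrable (fun ω => (∫ x, f x ∂(ν ω)) ^ 2) P) :
    randMeasDist P (fun ω => (μ ω).bind K) (fun ω => (ν ω).bind K) ≤
      randMeasDist P μ ν := by
  refine csSup_le_csSup (bddAbove_randMeasDist_set P μ ν hμprob hνprob)
    ⟨_, 0, measurable_const, by simp, rfl⟩ ?_
  rintro r ⟨f, hfm, hf, rfl⟩
  refine ⟨fun x ↦ ∫ y, f y ∂(K x), hfm.stronglyMeasurable.integral_kernel.measurable,
    fun x ↦ abs_integral_le_one_of_abs_le_one (K x) hf, ?_⟩
  simp only [integral_bind_kernel_of_abs_le_one _ K hfm hf]
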